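/- Let F be a field with char F ∉ {2,3,7} and let c ∈ F satisfy c^2 + c + 2 = 0. With P_1 = zD_3, P_2 = xD_1, P_3 = yD_2 and Q_1 = zC_2, Q_2 = xC_2, Q_3 = y((y^2−z^2)D_2 + C_3) as in the context, the nine degree-8 polynomials P_iQ_j, 1 ≤ i ≤ 3, 1 ≤ j ≤ 3, are linearly independent over F. -/

import Mathlib

open MvPolynomial

noncomputable section

/-- `C₃ = 4x⁴+4y⁴+(3c+9)x²y²+(5c−1)x²z²+(5c−1)y²z²+(15c+25)z⁴`. -/
def C₃ {F : Type*} [Field F] (c : F) : MvPolynomial (Fin 3) F :=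
  4 * X 0 ^ 4 + 4 * X 1 ^ 4 + C (3 * c + 9) * X 0 ^ 2 * X 1 ^ 2 +
    C (5 * c - 1) * X 0 ^ 2 * X 2 ^ 2 + C (5 * c - 1) * X 1 ^ 2 * X 2 ^ 2 +
    C (15 * c + 25) * X 2 ^ 4

/-- `C₁ = (15c+25)x⁴+4y⁴+(5c−1)x²y²+(5c−1)x²z²+(3c+9)y²z²+4z⁴`. -/
def C₁ {F : Type*} [Field F] (c : F) : MvPolynomial (Fin 3) F :=
  C (15 * c + 25) * X 0 ^ 4 + 4 * X 1 ^ 4 + C (5 * c - 1) * X 0 ^ 2 * X 1 ^ 2 +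
    C (5 * c - 1) * X 0 ^ 2 * X 2 ^ 2 + C (3 * c + 9) * X 1 ^ 2 * X 2 ^ 2 +
    4 * X 2 ^ 4

/-- `C₂ = 4x⁴+(15c+25)y⁴+(5c−1)x²y²+(3c+9)x²z²+(5c−1)y²z²+4z⁴`. -/
def C₂ {F : Type*} [Field F] (c : F) : MvPolynomial (Fin 3) F :=
  4 * X 0 ^ 4 + C (15 * c + 25) * X 1 ^ 4 + C (5 * c - 1) * X 0 ^ 2 * X 1 ^ 2 +
    C (3 * c + 9) * X 0 ^ 2 * X 2 ^ 2 + C (5 * c - 1) * X 1 ^ 2 * X 2 ^ 2 +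
    4 * X 2 ^ 4

/-- `D₃ = (15c+21)x²+(15c+21)y²+(2c−10)z²`. -/
def D₃ {F : Type*} [Field F] (c : F) : MvPolynomial (Fin 3) F :=
  C (15 * c + 21) * X 0 ^ 2 + C (15 * c + 21) * X 1 ^ 2 + C (2 * c - 10) * X 2 ^ 2

/-- `D₁ = (2c−10)x²+(15c+21)y²+(15c+21)z²`. -/
def D₁ {F : Type*} [Field F] (c : F) : MvPolynomial (Fin 3) F :=
  C (2 * c - 10) * X 0 ^ 2 + C (15 * c + 21) * X 1 ^ 2 + C (15 * c + 21) * X 2 ^ 2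

/-- `D₂ = (15c+21)x²+(2c−10)y²+(15c+21)z²`. -/
def D₂ {F : Type*} [Field F] (c : F) : MvPolynomial (Fin 3) F :=
  C (15 * c + 21) * X 0 ^ 2 + C (2 * c - 10) * X 1 ^ 2 + C (15 * c + 21) * X 2 ^ 2

/-- `f = xy(x²−y²)C₃`. -/
def kf {F : Type*} [Field F] (c : F) : MvPolynomial (Fin 3) F :=
  X 0 * X 1 * (X 0 ^ 2 - X 1 ^ 2) * C₃ c

/-- `g = yz(y²−z²)C₁`. -/
def kg {F : Type*} [Field F] (c : F) : MvPolynomial (Fin 3) F :=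
  X 1 * X 2 * (X 1 ^ 2 - X 2 ^ 2) * C₁ c

/-- `h = zx(z²−x²)C₂`. -/
def kh {F : Type*} [Field F] (c : F) : MvPolynomial (Fin 3) F :=
  X 2 * X 0 * (X 2 ^ 2 - X 0 ^ 2) * C₂ c

/-- The degree-3 syzygy `(P₁,P₂,P₃) = (zD₃, xD₁, yD₂)`. -/
def kP {F : Type*} [Field F] (c : F) : Fin 3 → MvPolynomial (Fin 3) F :=
  ![X 2 * D₃ c, X 0 * D₁ c, X 1 * D₂ c]

/-- The degree-5 syzygy `(Q₁,Q₂,Q₃) = (zC₂, xC₂, y((y²−z²)D₂ + C₃))`. -/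
def kQ {F : Type*} [Field F] (c : F) : Fin 3 → MvPolynomial (Fin 3) F :=
  ![X 2 * C₂ c, X 0 * C₂ c, X 1 * ((X 1 ^ 2 - X 2 ^ 2) * D₂ c + C₃ c)]

/-- The monomial `a xⁱ yʲ zᵏ`. -/
def ternaryMonomial {F : Type*} [Field F] (a : F) (i j k : ℕ) : MvPolynomial (Fin 3) F :=
  monomial (Finsupp.equivFunOnFinite.symm ![i, j, k]) a

/-- The coefficient of `xⁱ yʲ zᵏ`. -/
def ternaryCoeff {F : Type*} [Field F] (i j k : ℕ) (p : MvPolynomial (Fin 3) F) : F :=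
  coeff (Finsupp.equivFunOnFinite.symm ![i, j, k]) p

section

variable {F : Type*} [Field F]

theorem ternaryCoeff_add (i j k : ℕ) (p q : MvPolynomial (Fin 3) F) :
    ternaryCoeff i j k (p + q) = ternaryCoeff i j k p + ternaryCoeff i j k q :=
  coeff_add _ p q

theorem ternaryCoeff_smul (i j k : ℕ) (a : F) (p : MvPolynomial (Fin 3) F) :
    ternaryCoeff i j k (a • p) = a * ternaryCoeff i j k p :=
  coeff_smul _ a p

theorem ternaryCoeff_zero (i j k : ℕ) : ternaryCoeff i j k (0 : MvPolynomial (Fin 3) F) = 0 :=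
  coeff_zero _

theorem ternaryCoeff_ternaryMonomial (i j k i' j' k' : ℕ) (a : F) :
    ternaryCoeff i j k (ternaryMonomial a i' j' k') =
      if i' = i ∧ j' = j ∧ k' = k then a else 0 := by
  classical
  rw [ternaryCoeff, ternaryMonomial, coeff_monomial]
  simp

theorem ternaryMonomial_mul (a b : F) (i j k i' j' k' : ℕ) :
    ternaryMonomial a i j k * ternaryMonomial b i' j' k' =
      ternaryMonomial (a * b) (i + i') (j + j') (k + k') := by
  rw [ternaryMonomial, ternaryMonomial, monomial_mul, ternaryMonomial]
  congr 2
  ext t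
  fin_cases t <;> simp

theorem ternaryMonomial_eq (a : F) (i j k : ℕ) :
    ternaryMonomial a i j k = C a * X 0 ^ i * X 1 ^ j * X 2 ^ k := by
  rw [ternaryMonomial, monomial_eq, Finsupp.prod_fintype _ _ (by simp)]
  simp [Fin.prod_univ_three, mul_assoc]

theorem kP_eq (c : F) :
    kP c =
      ![ternaryMonomial (15 * c + 21) 2 0 1 + ternaryMonomial (15 * c + 21) 0 2 1 +
          ternaryMonomial (2 * c - 10) 0 0 3,
        ternaryMonomial (2 * c - 10) 3 0 0 + ternaryMonomial (15 * c + 21) 1 2 0 +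
          ternaryMonomial (15 * c + 21) 1 0 2,
        ternaryMonomial (15 * c + 21) 2 1 0 + ternaryMonomial (2 * c - 10) 0 3 0 +
          ternaryMonomial (15 * c + 21) 0 1 2] := by
  simp only [kP, D₁, D₂, D₃, ternaryMonomial_eq]
  congr! 1
  · ring
  congr! 1
  · ring
  congr! 1
  ring

theorem kQ_eq (c : F) :
    kQ c =
      ![ternaryMonomial 4 4 0 1 + ternaryMonomial (15 * c + 25) 0 4 1 +
          ternaryMonomial (5 * c - 1) 2 2 1 + ternaryMonomial (3 * c + 9) 2 0 3 +
          ternaryMonomial (5 * c - 1) 0 2 3 + ternaryMonomial 4 0 0 5,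
        ternaryMonomial 4 5 0 0 + ternaryMonomial (15 * c + 25) 1 4 0 +
          ternaryMonomial (5 * c - 1) 3 2 0 + ternaryMonomial (3 * c + 9) 3 0 2 +
          ternaryMonomial (5 * c - 1) 1 2 2 + ternaryMonomial 4 1 0 4,
        ternaryMonomial 4 4 1 0 + ternaryMonomial (2 * c - 6) 0 5 0 +
          ternaryMonomial (18 * c + 30) 2 3 0 + ternaryMonomial (-10 * c - 22) 2 1 2 +
          ternaryMonomial (18 * c + 30) 0 3 2 + ternaryMonomial 4 0 1 4] := by
  simp only [kQ, D₂, C₂, C₃, ternaryMonomial_eq, map_add, map_sub, map_mul, map_neg, map_ofNat,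
    map_one]
  congr! 1
  · ring
  congr! 1
  · ring
  congr! 1
  ring

theorem natCast_prime_ne_zero {p : ℕ} (hp : p.Prime) (h : ringChar F ≠ p) : (p : F) ≠ 0 := by
  rw [Ne, ringChar.spec, Nat.dvd_prime hp]
  exact fun h' => h'.elim (CharP.ringChar_ne_one) h

/-- A linear system with coefficient matrix `!![a, b; b, a]` is nondegenerate if `a ≠ ± b`. -/
theorem eq_zero_of_symmetric_system {a b s t : F} (hsub : a - b ≠ 0) (hadd : a + b ≠ 0)
    (h₁ : s * a + t * b = 0) (h₂ : s * b + t * a = 0) : s = 0 ∧ t = 0 := by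
  have hdet : (a - b) * (a + b) ≠ 0 := mul_ne_zero hsub hadd
  constructor
  · exact (mul_eq_zero.mp (by linear_combination a * h₁ - b * h₂ :
      s * ((a - b) * (a + b)) = 0)).resolve_right hdet
  · exact (mul_eq_zero.mp (by linear_combination a * h₂ - b * h₁ :
      t * ((a - b) * (a + b)) = 0)).resolve_right hdet

/-- A linear system with coefficient matrix `!![a, b; b, b]` is nondegenerate if `b ≠ 0` and
`a ≠ b`. -/
theorem eq_zero_of_degenerate_corner_system {a b s t : F} (hb : b ≠ 0) (hsub : a - b ≠ 0)
    (h₁ : s * a + t * b = 0) (h₂ : s * b + t * b = 0) : s = 0 ∧ t = 0 := by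
  have hs : s = 0 := (mul_eq_zero.mp (by linear_combination h₁ - h₂ :
      s * (a - b) = 0)).resolve_right hsub
  exact ⟨hs, (mul_eq_zero.mp (by simpa [hs] using h₂)).resolve_right hb⟩

end

/-- the nine degree-8 forms `P_i·Q_j` are linearly independent. -/
theorem klein_PiQj_linearIndependent {F : Type*} [Field F] (c : F)
    (hc : c ^ 2 + c + 2 = 0) (h2 : ringChar F ≠ 2) (h3 : ringChar F ≠ 3)
    (h7 : ringChar F ≠ 7) :
    LinearIndependent F (fun p : Fin 3 × Fin 3 => kP c p.1 * kQ c p.2) := by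
  have two_ne : (2 : F) ≠ 0 := mod_cast natCast_prime_ne_zero Nat.prime_two h2
  have three_ne : (3 : F) ≠ 0 := mod_cast natCast_prime_ne_zero Nat.prime_three h3
  have seven_ne : (7 : F) ≠ 0 := mod_cast natCast_prime_ne_zero (by norm_num) h7
  have ha : (2 * c - 10) * 4 ≠ 0 := fun h => pow_ne_zero 9 two_ne (by
    linear_combination (-12 - 2 * c) * h + 16 * hc)
  have hb : (15 * c + 21) * 4 ≠ 0 := fun h =>
    mul_ne_zero (pow_ne_zero 8 two_ne) (pow_ne_zero 2 three_ne) (by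
      linear_combination (6 - 15 * c) * h + 900 * hc)
  have hsub : (2 * c - 10) * 4 - (15 * c + 21) * 4 ≠ 0 := fun h =>
    mul_ne_zero (pow_ne_zero 9 two_ne) seven_ne (by
      linear_combination (-18 + 13 * c) * h + 676 * hc)
  have hadd : (2 * c - 10) * 4 + (15 * c + 21) * 4 ≠ 0 := fun h =>
    pow_ne_zero 11 two_ne (by linear_combination (-6 - 17 * c) * h + 1156 * hc)
  rw [Fintype.linearIndependent_iff]
  intro g hg
  simp only [Fintype.sum_prod_type, Fin.sum_univ_three, kP_eq, kQ_eq, Matrix.cons_val,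
    mul_add, add_mul, ternaryMonomial_mul, Nat.reduceAdd] at hg
  have hcoeff (i j k : ℕ) := congrArg (ternaryCoeff i j k) hg
  simp only [ternaryCoeff_add, ternaryCoeff_smul, ternaryCoeff_zero,
    ternaryCoeff_ternaryMonomial] at hcoeff
  have hz8 := hcoeff 0 0 8
  have hx8 := hcoeff 8 0 0
  have hy2z6 := hcoeff 0 2 6
  have hxz7 := hcoeff 1 0 7
  have hx7z := hcoeff 7 0 1
  have hyz7 := hcoeff 0 1 7
  have hx6yz := hcoeff 6 1 1
  have hxyz6 := hcoeff 1 1 6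
  have hx7y := hcoeff 7 1 0
  clear hg hcoeff
  simp [-mul_eq_zero] at hz8 hx8 hy2z6 hxz7 hx7z hyz7 hx6yz hxyz6 hx7y
  have h00 : g (0, 0) = 0 := (mul_eq_zero.mp hz8).resolve_right ha
  have h11 : g (1, 1) = 0 := (mul_eq_zero.mp hx8).resolve_right ha
  have h22 : g (2, 2) = 0 := (mul_eq_zero.mp (by linear_combination hy2z6 -
    ((2 * c - 10) * (5 * c - 1) + (15 * c + 21) * 4) * h00 :
      g (2, 2) * ((15 * c + 21) * 4) = 0)).resolve_right hb
  obtain ⟨h01, h10⟩ := eq_zero_of_symmetric_system (s := g (0, 1)) (t := g (1, 0)) hsub hadd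
    (by linear_combination hxz7) (by linear_combination hx7z)
  obtain ⟨h02, h20⟩ := eq_zero_of_degenerate_corner_system (s := g (0, 2)) (t := g (2, 0)) hb hsub
    (by linear_combination hyz7) (by linear_combination hx6yz)
  obtain ⟨h12, h21⟩ := eq_zero_of_degenerate_corner_system (s := g (1, 2)) (t := g (2, 1)) hb hsub
    (by linear_combination hx7y) (by linear_combination hxyz6)
  rintro ⟨i, j⟩
  fin_cases i <;> fin_cases j <;> assumption

end
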